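/- arXiv:2112.14670 — 7 statements merged into one kernel-verified Lean document; each statement's English description precedes it below -/
import Mathlib

section
/- Let M be an additively written commutative group and let B : M × M → ℂ be additive in each argument and antisymmetric (B(x,y) = −B(y,x) for all x, y ∈ M). Suppose a, b, c, d, e, f, i, j, k, l, m, n ∈ M satisfy the conservation laws a + b = i + j, i + c = d + k, j + k = e + f, b + c = n + l, m + l = d + e, and a + n = m + f. Then B(a,b) + B(i,j) + B(i,c) + B(d,k) + B(j,k) + B(e,f) = B(a,n) + B(m,f) + B(b,c) + B(l,n) + B(m,l) + B(d,e). (This is the core of Proposition 'Yang–Baxter solvability is invariant under the standard Drinfeld twist': the twist factors attached to the two sides of a Yang–Baxter equation agree for every choice of internal labels satisfying the conservation laws.) -/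
/-- core of the invariance of Yang–Baxter solvability under the standard
Drinfeld twist: let `M` be an additively written commutative group and `B : M × M → ℂ`
additive in each argument and antisymmetric.  If the labels satisfy the conservation laws
of the two sides of a Yang–Baxter equation, then the twist factors attached to the two
sides agree. -/
theorem standard_drinfeld_twist_invariance
    (M : Type*) [AddCommGroup M] (B : M × M → ℂ)
    (haddL : ∀ x y z : M, B (x + y, z) = B (x, z) + B (y, z))
    (haddR : ∀ x y z : M, B (x, y + z) = B (x, y) + B (x, z))
    (hanti : ∀ x y : M, B (x, y) = -B (y, x))
    (a b c d e f i j k l m n : M)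
    (h1 : a + b = i + j) (h2 : i + c = d + k) (h3 : j + k = e + f)
    (h4 : b + c = n + l) (h5 : m + l = d + e) (h6 : a + n = m + f) :
    B (a, b) + B (i, j) + B (i, c) + B (d, k) + B (j, k) + B (e, f) =
      B (a, n) + B (m, f) + B (b, c) + B (l, n) + B (m, l) + B (d, e) := by
  have hsubL (x y z : M) : B (x - y, z) = B (x, z) - B (y, z) := by
    rw [eq_sub_iff_add_eq, ← haddL, sub_add_cancel]
  have hsubR (x y z : M) : B (x, y - z) = B (x, y) - B (x, z) := by
    rw [eq_sub_iff_add_eq, ← haddR, sub_add_cancel]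
  have hself (x : M) : B (x, x) = 0 := self_eq_neg.mp (hanti x x)
  obtain rfl : j = a + b - i := eq_sub_of_add_eq' h1.symm
  obtain rfl : d = i + c - k := eq_sub_of_add_eq h2.symm
  obtain rfl : f = a + b - i + k - e := eq_sub_of_add_eq' h3.symm
  obtain rfl : l = b + c - n := eq_sub_of_add_eq' h4.symm
  obtain rfl : m = i + c - k + e - (b + c - n) := eq_sub_of_add_eq h5
  simp only [haddL, haddR, hsubL, hsubR, hself]
  grind
end

section
/- The normalized constants α̃_i satisfy the quadratic, braid and commutation relations of the simple reflections: for all σ ∈ (ℤ/mℤ)^r, (1) α̃_i(s_iσ)·α̃_i(σ) = 1 for 1 ≤ i ≤ r−1; (2) α̃_i(s_{i+1}s_iσ)·α̃_{i+1}(s_iσ)·α̃_i(σ) = α̃_{i+1}(s_is_{i+1}σ)·α̃_i(s_{i+1}σ)·α̃_{i+1}(σ) for 1 ≤ i ≤ r−2; (3) α̃_i(s_jσ)·α̃_j(σ) = α̃_j(s_iσ)·α̃_i(σ) whenever |i − j| ≥ 2. In particular, for any w ∈ S_r, the product α̃_w(σ) := α̃_{i_1}(s_{i_2}⋯s_{i_k}σ)·α̃_{i_2}(s_{i_3}⋯s_{i_k}σ)⋯α̃_{i_k}(σ)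 is independent of the choice of reduced expression w = s_{i_1}s_{i_2}⋯s_{i_k}. -/
noncomputable section

/-- The representative in `{1, …, m}` of a residue class mod `m`:
`rep m x ≡ x (mod m)` and `rep m x ∈ {1, …, m}`. -/
def rep (m : ℕ) (x : ZMod m) : ℕ := (x - 1).val + 1

/-- Indices of adjacent transpositions `s_i` of `S_r` (for `1 ≤ i ≤ r − 1`, stored
0-indexed as `i` with `i + 1 < r`). -/
abbrev AIdx (r : ℕ) := {i : ℕ // i + 1 < r}

def idx0 {r : ℕ} (i : AIdx r) : Fin r := ⟨i.1, Nat.lt_of_succ_lt i.2⟩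

def idx1 {r : ℕ} (i : AIdx r) : Fin r := ⟨i.1 + 1, i.2⟩

/-- The simple reflection `s_i ∈ S_r`, the transposition of `i` and `i + 1`. -/
def sw {r : ℕ} (i : AIdx r) : Equiv.Perm (Fin r) := Equiv.swap (idx0 i) (idx1 i)

/-- The action of `S_r` on `r`-tuples by permuting components: `(u • σ)_i = σ_{u⁻¹(i)}`. -/
def pact {r : ℕ} {X : Type*} (u : Equiv.Perm (Fin r)) (σ : Fin r → X) : Fin r → X :=
  fun k => σ (u⁻¹ k)

/-- The product `s_{i_1} s_{i_2} ⋯ s_{i_k}` of the word `L = [i_1, …, i_k]`. -/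
def wordProd {r : ℕ} (L : List (AIdx r)) : Equiv.Perm (Fin r) := (L.map sw).prod

/-- The length `ℓ(w)` of `w ∈ S_r`: the number of inversions. -/
def invCount {r : ℕ} (w : Equiv.Perm (Fin r)) : ℕ :=
  (Finset.univ.filter fun p : Fin r × Fin r => p.1 < p.2 ∧ w p.2 < w p.1).card

/-- `ε(σ, i, j) = 1` if `σ_i > σ_j`, `0` if `σ_i = σ_j`, `−1` if `σ_i < σ_j`
(comparing representatives in `{1, …, m}`); used for the adjacent pair `j = i + 1`. -/
def eps (m : ℕ) {r : ℕ} (σ : Fin r → ZMod m) (i j : Fin r) : ℤ :=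
  if rep m (σ j) < rep m (σ i) then 1 else if rep m (σ i) = rep m (σ j) then 0 else -1

/-- The normalized constant `α̃_i(σ) = α_{−σ_{i+1}, −σ_i} · q^{ε(σ,i)}`, evaluated at the
adjacent pair `(i, j) = (i, i + 1)`. -/
def alphaT (m : ℕ) (q : ℂ) (α : ZMod m → ZMod m → ℂ) {r : ℕ}
    (σ : Fin r → ZMod m) (i j : Fin r) : ℂ :=
  α (-(σ j)) (-(σ i)) * q ^ eps m σ i j

/-- For a word `L = [i_1, …, i_k]`, the product
`α̃_{i_1}(s_{i_2}⋯s_{i_k}σ) · α̃_{i_2}(s_{i_3}⋯s_{i_k}σ) ⋯ α̃_{i_k}(σ)`. -/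
def alphaTWord (m : ℕ) (q : ℂ) (α : ZMod m → ZMod m → ℂ) {r : ℕ} :
    List (AIdx r) → (Fin r → ZMod m) → ℂ
  | [], _ => 1
  | i :: L, σ => alphaT m q α (pact (wordProd L) σ) (idx0 i) (idx1 i) * alphaTWord m q α L σ

/-- The factor `α_{−y, −x} · q^{ε}` attached to a pair of values `(x, y)`. -/
def pairFactor (m : ℕ) (q : ℂ) (α : ZMod m → ZMod m → ℂ) (x y : ZMod m) : ℂ :=
  α (-y) (-x) *
    q ^ (if rep m y < rep m x then 1 else if rep m x = rep m y then 0 else -1 : ℤ)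

theorem alphaT_eq_pairFactor (m : ℕ) (q : ℂ) (α : ZMod m → ZMod m → ℂ) {r : ℕ}
    (σ : Fin r → ZMod m) (i j : Fin r) :
    alphaT m q α σ i j = pairFactor m q α (σ i) (σ j) := rfl

theorem pairFactor_mul_swap (m : ℕ) {q : ℂ} (hq : q ≠ 0) {α : ZMod m → ZMod m → ℂ}
    (hα : ∀ x y, α x y * α y x = 1) (x y : ZMod m) :
    pairFactor m q α x y * pairFactor m q α y x = 1 := by
  unfold pairFactor
  rw [mul_mul_mul_comm, hα, one_mul, ← zpow_add₀ hq]
  rcases lt_trichotomy (rep m x) (rep m y) with h | h | h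
  · simp [h, h.not_gt, h.ne]
  · simp [h]
  · simp [h, h.not_gt, h.ne]

/-- The set of inversions of a permutation. -/
def invSet {r : ℕ} (w : Equiv.Perm (Fin r)) : Finset (Fin r × Fin r) :=
  Finset.univ.filter fun p : Fin r × Fin r => p.1 < p.2 ∧ w p.2 < w p.1

theorem mem_invSet {r : ℕ} {w : Equiv.Perm (Fin r)} {p : Fin r × Fin r} :
    p ∈ invSet w ↔ p.1 < p.2 ∧ w p.2 < w p.1 := by
  rw [invSet, Finset.mem_filter_univ]

theorem notMem_invSet {r : ℕ} (w : Equiv.Perm (Fin r)) (i : AIdx r) :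
    (w⁻¹ (idx0 i), w⁻¹ (idx1 i)) ∉ invSet w := by
  simp [invSet, idx0, idx1]

theorem invSet_sw_mul {r : ℕ} (w : Equiv.Perm (Fin r)) (i : AIdx r)
    (h : w⁻¹ (idx0 i) < w⁻¹ (idx1 i)) :
    invSet (sw i * w) = insert (w⁻¹ (idx0 i), w⁻¹ (idx1 i)) (invSet w) := by
  ext ⟨a, b⟩
  obtain ⟨x, rfl⟩ := w⁻¹.surjective a
  obtain ⟨y, rfl⟩ := w⁻¹.surjective b
  have hw : ∀ z, w (w⁻¹ z) = z := w.apply_symm_apply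
  have key : w⁻¹ x < w⁻¹ y → (sw i y < sw i x ↔ (x = idx0 i ∧ y = idx1 i) ∨ y < x) := by
    intro hxy
    have hne : ¬ (x = idx1 i ∧ y = idx0 i) := by
      rintro ⟨rfl, rfl⟩
      exact lt_asymm h hxy
    have hxy' : x ≠ y := by
      rintro rfl
      exact lt_irrefl _ hxy
    simp only [sw, Equiv.swap_apply_def]
    simp only [idx0, idx1, Fin.ext_iff, Fin.lt_def, ne_eq] at *
    split_ifs <;> (try dsimp only) <;> omega
  simp only [Finset.mem_insert, mem_invSet,
    Prod.mk.injEq, EmbeddingLike.apply_eq_iff_eq, Equiv.Perm.mul_apply,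
    hw]
  constructor
  · rintro ⟨h1, h2⟩
    exact ((key h1).1 h2).imp id (⟨h1, ·⟩)
  · rintro (⟨rfl, rfl⟩ | ⟨h1, h2⟩)
    · exact ⟨h, (key h).2 (.inl ⟨rfl, rfl⟩)⟩
    · exact ⟨h1, (key h1).2 (.inr h2)⟩

theorem sw_mul_self {r : ℕ} (i : AIdx r) : sw i * sw i = 1 := Equiv.swap_mul_self _ _

theorem prod_invSet_sw_mul {r m : ℕ} {q : ℂ} (hq : q ≠ 0) {α : ZMod m → ZMod m → ℂ}
    (hα : ∀ x y, α x y * α y x = 1) (σ : Fin r → ZMod m) (w : Equiv.Perm (Fin r))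
    (i : AIdx r) :
    ∏ p ∈ invSet (sw i * w), pairFactor m q α (σ p.1) (σ p.2) =
      alphaT m q α (pact w σ) (idx0 i) (idx1 i) *
        ∏ p ∈ invSet w, pairFactor m q α (σ p.1) (σ p.2) := by
  rw [alphaT_eq_pairFactor, pact, pact]
  rcases lt_or_ge (w⁻¹ (idx0 i)) (w⁻¹ (idx1 i)) with h | h
  · rw [invSet_sw_mul w i h, Finset.prod_insert (notMem_invSet w i)]
  · have hne : w⁻¹ (idx1 i) ≠ w⁻¹ (idx0 i) := by simp [idx0, idx1]
    have e0 : (sw i * w)⁻¹ (idx0 i) = w⁻¹ (idx1 i) := by simp [sw]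
    have e1 : (sw i * w)⁻¹ (idx1 i) = w⁻¹ (idx0 i) := by simp [sw]
    have hw : sw i * (sw i * w) = w := by rw [← mul_assoc, sw_mul_self, one_mul]
    have hs := invSet_sw_mul (sw i * w) i (by rw [e0, e1]; exact lt_of_le_of_ne h hne)
    have hn := notMem_invSet (sw i * w) i
    rw [hw, e0, e1] at hs
    rw [e0, e1] at hn
    rw [hs, Finset.prod_insert hn, ← mul_assoc, pairFactor_mul_swap m hq hα, one_mul]

/-- For any word, reduced or not, the product of the normalized constants is a product over
the inversions of the permutation it represents. -/
theorem alphaTWord_eq_prod_invSet {r m : ℕ} {q : ℂ} (hq : q ≠ 0) {α : ZMod m → ZMod m → ℂ}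
    (hα : ∀ x y, α x y * α y x = 1) (σ : Fin r → ZMod m) (L : List (AIdx r)) :
    alphaTWord m q α L σ =
      ∏ p ∈ invSet (wordProd L), pairFactor m q α (σ p.1) (σ p.2) := by
  induction L with
  | nil =>
    refine (Finset.prod_eq_one fun p hp => ?_).symm
    rw [mem_invSet] at hp
    exact absurd hp.2 hp.1.not_gt
  | cons i L ih =>
    have h : wordProd (i :: L) = sw i * wordProd L := by simp [wordProd]
    rw [alphaTWord, ih, h, prod_invSet_sw_mul hq hα]

theorem alphaTWord_congr {r m : ℕ} {q : ℂ} (hq : q ≠ 0) {α : ZMod m → ZMod m → ℂ}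
    (hα : ∀ x y, α x y * α y x = 1) (σ : Fin r → ZMod m) {L L' : List (AIdx r)}
    (h : wordProd L = wordProd L') : alphaTWord m q α L σ = alphaTWord m q α L' σ := by
  rw [alphaTWord_eq_prod_invSet hq hα, alphaTWord_eq_prod_invSet hq hα, h]

theorem sw_braid {r : ℕ} (i j : AIdx r) (h : j.1 = i.1 + 1) :
    sw i * (sw j * sw i) = sw j * (sw i * sw j) := by
  have hj : idx0 j = idx1 i := Fin.ext h
  have h01 : idx0 i ≠ idx1 i := by simp [idx0, idx1]
  have h02 : idx0 i ≠ idx1 j := by simp [idx0, idx1, h]; omega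
  have h12 : idx1 i ≠ idx1 j := by simp [idx1, h]
  rw [← mul_assoc, ← mul_assoc, sw, sw, hj, Equiv.swap_mul_swap_mul_swap h01 h02,
    Equiv.swap_comm (idx0 i), Equiv.swap_comm (idx1 i) (idx1 j),
    Equiv.swap_mul_swap_mul_swap h12.symm h02.symm,
    Equiv.swap_comm]

theorem sw_comm {r : ℕ} (i j : AIdx r) (h : i.1 + 2 ≤ j.1 ∨ j.1 + 2 ≤ i.1) :
    sw i * sw j = sw j * sw i := by
  refine (Equiv.Perm.disjoint_swap_swap ?_).commute
  simp only [idx0, idx1, List.nodup_cons, List.mem_cons, Fin.ext_iff, List.not_mem_nil,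
    List.nodup_nil, or_false, not_false_eq_true, and_true]
  omega

theorem pact_one {r : ℕ} {X : Type*} (σ : Fin r → X) : pact 1 σ = σ := rfl

/-- the normalized constants `α̃_i` satisfy the quadratic, braid and
commutation relations of the simple reflections, and consequently `α̃_w(σ)` is
independent of the choice of reduced expression for `w`. -/
theorem alphaT_relations_and_word_independence
    (m r : ℕ) [NeZero m] (q : ℂ) (hq : q ≠ 0)
    (α : ZMod m → ZMod m → ℂ) (hα : ∀ x y, α x y * α y x = 1) (hα1 : ∀ x, α x x = 1) :
    -- (1) quadratic relation
    (∀ (σ : Fin r → ZMod m) (i : AIdx r),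
        alphaT m q α (pact (sw i) σ) (idx0 i) (idx1 i) *
          alphaT m q α σ (idx0 i) (idx1 i) = 1) ∧
    -- (2) braid relation
    (∀ (σ : Fin r → ZMod m) (i : ℕ) (h : i + 2 < r),
        alphaT m q α (pact (sw ⟨i + 1, h⟩ * sw ⟨i, Nat.lt_of_succ_lt h⟩) σ)
            (idx0 ⟨i, Nat.lt_of_succ_lt h⟩) (idx1 ⟨i, Nat.lt_of_succ_lt h⟩) *
          alphaT m q α (pact (sw ⟨i, Nat.lt_of_succ_lt h⟩) σ)
            (idx0 ⟨i + 1, h⟩) (idx1 ⟨i + 1, h⟩) *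
          alphaT m q α σ (idx0 ⟨i, Nat.lt_of_succ_lt h⟩) (idx1 ⟨i, Nat.lt_of_succ_lt h⟩) =
        alphaT m q α (pact (sw ⟨i, Nat.lt_of_succ_lt h⟩ * sw ⟨i + 1, h⟩) σ)
            (idx0 ⟨i + 1, h⟩) (idx1 ⟨i + 1, h⟩) *
          alphaT m q α (pact (sw ⟨i + 1, h⟩) σ)
            (idx0 ⟨i, Nat.lt_of_succ_lt h⟩) (idx1 ⟨i, Nat.lt_of_succ_lt h⟩) *
          alphaT m q α σ (idx0 ⟨i + 1, h⟩) (idx1 ⟨i + 1, h⟩)) ∧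
    -- (3) commutation relation for |i − j| ≥ 2
    (∀ (σ : Fin r → ZMod m) (i j : AIdx r), i.1 + 2 ≤ j.1 ∨ j.1 + 2 ≤ i.1 →
        alphaT m q α (pact (sw j) σ) (idx0 i) (idx1 i) *
          alphaT m q α σ (idx0 j) (idx1 j) =
        alphaT m q α (pact (sw i) σ) (idx0 j) (idx1 j) *
          alphaT m q α σ (idx0 i) (idx1 i)) ∧
    -- independence of the reduced expression
    (∀ (w : Equiv.Perm (Fin r)) (L1 L2 : List (AIdx r)),
        wordProd L1 = w → wordProd L2 = w →
        L1.length = invCount w → L2.length = invCount w →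
        ∀ σ : Fin r → ZMod m, alphaTWord m q α L1 σ = alphaTWord m q α L2 σ) := by
  refine ⟨fun σ i => ?_, fun σ i h => ?_, fun σ i j hij => ?_,
    fun w L1 L2 h1 h2 _ _ σ => alphaTWord_congr hq hα σ (h1.trans h2.symm)⟩
  · simpa [alphaTWord, wordProd, pact_one] using
      alphaTWord_congr hq hα σ (L := [i, i]) (L' := []) (by simp [wordProd, sw_mul_self])
  · simpa [alphaTWord, wordProd, pact_one, mul_assoc] using
      alphaTWord_congr hq hα σ
        (L := [⟨i, Nat.lt_of_succ_lt h⟩, ⟨i + 1, h⟩, ⟨i, Nat.lt_of_succ_lt h⟩])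
        (L' := [⟨i + 1, h⟩, ⟨i, Nat.lt_of_succ_lt h⟩, ⟨i + 1, h⟩])
        (by simpa [wordProd] using sw_braid ⟨i, Nat.lt_of_succ_lt h⟩ ⟨i + 1, h⟩ rfl)
  · simpa [alphaTWord, wordProd, pact_one] using
      alphaTWord_congr hq hα σ (L := [i, j]) (L' := [j, i])
        (by simpa [wordProd] using sw_comm i j hij)
end
end

section
/- If the multiset of residue classes {−μ_1 mod m, −μ_2 mod m, …, −μ_r mod m} in ℤ/mℤ is not equal (as a multiset) to the multiset {σ_1, …, σ_r}, then the system 𝔖^m_{μ,σ} has no admissible states; in particular Z(𝔖^m_{μ,σ})(z_1,…,z_r) = 0. -/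
noncomputable section

/-- A spin: either `+` (`none`) or a color `c_i` represented by the residue class
`i mod m` of its index `i ∈ {1, …, m}` (`some` of that class). -/
abbrev Spin (m : ℕ) := Option (ZMod m)

/-- Boltzmann weight of a T-vertex with column color (class) `j` and row parameter `z`,
on the spins `(a, b, c, d)` of its (left, top, right, bottom) edges; inadmissible
configurations get weight `0`. -/
def wt (m : ℕ) (q Φ : ℂ) (α : ZMod m → ZMod m → ℂ) (j : ZMod m) (z : ℂ) :
    Spin m → Spin m → Spin m → Spin m → ℂ
  | some a, some b, some c, some d =>
      if b = j ∧ d = j ∧ c = a then (if a = j then Φ * q * z else Φ * α (-a) (-j)) else 0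
  | none, some b, none, some d => if b = j ∧ d = j then -Φ / q else 0
  | some a, none, some c, none => if c = a then (if a = j then z else 1) else 0
  | some a, none, none, some d => if a = j ∧ d = j then -(Φ / q) * (1 - q ^ 2) * z else 0
  | none, some b, some c, none => if b = j ∧ c = j then 1 else 0
  | none, none, none, none => 1
  | _, _, _, _ => 0

/-- The admissible configurations `(a, b, c, d)` = (left, top, right, bottom) of a
T-vertex with column color (class) `j`. -/
def Adm (m : ℕ) (j : ZMod m) (a b c d : Spin m) : Prop :=
  (a = none ∧ b = none ∧ c = none ∧ d = none) ∨
  (∃ i : ZMod m, a = some i ∧ b = some j ∧ c = some i ∧ d = some j) ∨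
  (a = none ∧ b = some j ∧ c = none ∧ d = some j) ∨
  (∃ i : ZMod m, a = some i ∧ b = none ∧ c = some i ∧ d = none) ∨
  (a = some j ∧ b = none ∧ c = none ∧ d = some j) ∨
  (a = none ∧ b = some j ∧ c = some j ∧ d = none)

/-- A spin configuration of the `r × N` grid: `s.1 i p` is the spin of the horizontal
edge of row `i` which is the right edge of column `p` (so `s.1 i 0` is the right
boundary edge of row `i` and `s.1 i (Fin.last N)` the left boundary edge), and
`s.2 i k` records whether the vertical edge of column `k` on row-boundary `i` is
occupied (columns are numbered `0, …, N − 1` from the right). -/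
abbrev GState (m r N : ℕ) := (Fin r → Fin (N + 1) → Spin m) × (Fin (r + 1) → Fin N → Bool)

/-- The column color (class) of column number `k`: `j(k) ≡ −k (mod m)`. -/
def colC (m k : ℕ) : ZMod m := -(k : ZMod m)

/-- The spin of the vertical edge of column `k` on row-boundary `i`. -/
def vspin {m r N : ℕ} (s : GState m r N) (i : Fin (r + 1)) (k : Fin N) : Spin m :=
  if s.2 i k then some (colC m k) else none

/-- `s` is an admissible state of the system `𝔖^m_{μ,σ}`: the left and bottom boundary
edges carry `+`, the top boundary vertical edge in column `k` is occupied iff `k` is a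
part of `μ`, the right boundary edge of row `i` carries the color `c_{σ_i}`, and every
vertex is in an admissible configuration. -/
def IsState {m r N : ℕ} (μ : Fin r → ℕ) (σ : Fin r → ZMod m) (s : GState m r N) : Prop :=
  (∀ i, s.1 i (Fin.last N) = none) ∧
  (∀ i, s.1 i 0 = some (σ i)) ∧
  (∀ k : Fin N, (s.2 0 k = true ↔ ∃ i, μ i = (k : ℕ))) ∧
  (∀ k, s.2 (Fin.last r) k = false) ∧
  (∀ (i : Fin r) (k : Fin N),
    Adm m (colC m k) (s.1 i k.succ) (vspin s i.castSucc k) (s.1 i k.castSucc)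
      (vspin s i.succ k))

/-- The Boltzmann weight of a state: the product of the weights of all its vertices. -/
def swt {m r N : ℕ} (q Φ : ℂ) (α : ZMod m → ZMod m → ℂ) (z : Fin r → ℂ)
    (s : GState m r N) : ℂ :=
  ∏ i : Fin r, ∏ k : Fin N,
    wt m q Φ α (colC m k) (z i) (s.1 i k.succ) (vspin s i.castSucc k) (s.1 i k.castSucc)
      (vspin s i.succ k)

open Classical in
/-- The partition function `Z(𝔖^m_{μ,σ})(z_1, …, z_r)`: the sum of the weights of all
admissible states of the system `𝔖^m_{μ,σ}`. -/
def Z (m : ℕ) [NeZero m] (r N : ℕ) (q Φ : ℂ) (α : ZMod m → ZMod m → ℂ)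
    (μ : Fin r → ℕ) (σ : Fin r → ZMod m) (z : Fin r → ℂ) : ℂ :=
  ∑ s : GState m r N, if IsState μ σ s then swt q Φ α z s else 0

/-- The multiset of colors carried by an edge: empty for `+`. -/
def Spin.colors {m : ℕ} (a : Spin m) : Multiset (ZMod m) :=
  a.elim 0 fun c => {c}

/-- Color conservation at an admissible vertex. -/
theorem Adm.colors_add {m : ℕ} {j : ZMod m} {a b c d : Spin m} (h : Adm m j a b c d) :
    Spin.colors c + Spin.colors d = Spin.colors a + Spin.colors b := by
  rcases h with ⟨rfl, rfl, rfl, rfl⟩ | ⟨i, rfl, rfl, rfl, rfl⟩ | ⟨rfl, rfl, rfl, rfl⟩ |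
    ⟨i, rfl, rfl, rfl, rfl⟩ | ⟨rfl, rfl, rfl, rfl⟩ | ⟨rfl, rfl, rfl, rfl⟩ <;>
  simp [Spin.colors]

/-- Telescoping without subtraction. -/
theorem Fin.add_sum_eq_of_castSucc_add_eq {M : Type*} [AddCancelCommMonoid M] {n : ℕ}
    (f : Fin (n + 1) → M) (a b : Fin n → M)
    (h : ∀ k : Fin n, f k.castSucc + a k = f k.succ + b k) :
    f 0 + ∑ k, a k = f (Fin.last n) + ∑ k, b k := by
  have hsum : ∑ k : Fin n, f k.castSucc + ∑ k, a k = ∑ k : Fin n, f k.succ + ∑ k, b k := by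
    simp only [← Finset.sum_add_distrib, h]
  have hf := (Fin.sum_univ_succ f).symm.trans (Fin.sum_univ_castSucc f)
  apply add_left_cancel (a := ∑ k : Fin n, f k.succ)
  calc _ = (f 0 + ∑ k : Fin n, f k.succ) + ∑ k, a k := by abel
    _ = (∑ k : Fin n, f k.castSucc + ∑ k, a k) + f (Fin.last n) := by rw [hf]; abel
    _ = _ := by rw [hsum]; abel

theorem sum_colors_vspin_zero {m r N : ℕ} {μ : Fin r → ℕ} (hμ : Function.Injective μ)
    (hμN : ∀ i, μ i < N) {s : GState m r N}
    (hs : ∀ k : Fin N, s.2 0 k = true ↔ ∃ i, μ i = (k : ℕ)) :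
    ∑ k, Spin.colors (vspin s 0 k) = ∑ i, {-(μ i : ZMod m)} := by
  symm
  refine Finset.sum_of_injOn (fun i => (⟨μ i, hμN i⟩ : Fin N)) ?_ (by simp) ?_ ?_
  · intro i _ j _ hij
    exact hμ (Fin.mk.inj hij)
  · intro k _ hk
    have : s.2 0 k = false := by
      rw [← Bool.not_eq_true, hs]
      rintro ⟨i, hi⟩
      exact hk ⟨i, by simp, Fin.ext hi⟩
    simp [vspin, this, Spin.colors]
  · intro i _
    simp [vspin, (hs ⟨μ i, hμN i⟩).2 ⟨i, rfl⟩, Spin.colors, colC]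

/-- Color conservation for a state: the colors entering at the top leave at the right. -/
theorem IsState.map_eq {m r N : ℕ} {μ : Fin r → ℕ} (hμ : Function.Injective μ)
    (hμN : ∀ i, μ i < N) {σ : Fin r → ZMod m} {s : GState m r N} (hs : IsState μ σ s) :
    Multiset.map (fun i => -(μ i : ZMod m)) Finset.univ.val =
      Multiset.map σ Finset.univ.val := by
  obtain ⟨hleft, hright, htop, hbot, hadm⟩ := hs
  have hrow (i : Fin r) := Fin.add_sum_eq_of_castSucc_add_eq
    (fun p => Spin.colors (s.1 i p)) _ _ fun k => (hadm i k).colors_add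
  have htotal := Fin.add_sum_eq_of_castSucc_add_eq
    (fun i => ∑ k, Spin.colors (vspin s i k)) (fun _ => 0) (fun i => {σ i}) fun i => by
      have h := hrow i
      simp only [hleft, hright] at h
      simpa [Spin.colors, add_comm] using h.symm
  simp only [sum_colors_vspin_zero hμ hμN htop] at htotal
  have hmap (f : Fin r → ZMod m) : Multiset.map f Finset.univ.val = ∑ i, {f i} := by
    rw [← Multiset.sum_map_singleton (Multiset.map f _), Multiset.map_map]
    rfl
  simpa [hmap, vspin, hbot, Spin.colors] using htotal

/-- if the multiset of residue classes `{−μ_i mod m}` is not a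
permutation of the multiset `{σ_i}`, then the system `𝔖^m_{μ,σ}` has no admissible
states; in particular its partition function vanishes. -/
theorem no_states_of_multiset_ne
    (m : ℕ) [NeZero m] (r N : ℕ) (q Φ : ℂ) (hq : q ≠ 0) (hΦ : Φ ≠ 0)
    (α : ZMod m → ZMod m → ℂ) (hα : ∀ x y, α x y * α y x = 1) (hα1 : ∀ x, α x x = 1)
    (μ : Fin r → ℕ) (hμ : StrictAnti μ) (hμN : ∀ i, μ i < N)
    (σ : Fin r → ZMod m)
    (hmult : Multiset.map (fun i => -(μ i : ZMod m)) Finset.univ.val ≠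
      Multiset.map σ Finset.univ.val) :
    (¬ ∃ s : GState m r N, IsState μ σ s) ∧
      ∀ z : Fin r → ℂ, (∀ i, z i ≠ 0) → Z m r N q Φ α μ σ z = 0 := by
  have hno : ¬ ∃ s : GState m r N, IsState μ σ s :=
    fun ⟨_, hs⟩ => hmult (hs.map_eq hμ.injective hμN)
  exact ⟨hno, fun z _ => Finset.sum_eq_zero fun s _ => if_neg fun hs => hno ⟨s, hs⟩⟩
end
end

section
/- Monostatic systems: Suppose σ ∈ (ℤ/mℤ)^r has pairwise distinct components and σ_i ≡ −μ_i (mod m) for every i = 1, …, r. Then the system 𝔖^m_{μ,σ} contains exactly one admissible state, and its partition function equals Z(𝔖^m_{μ,σ})(z_1,…,z_r) = Φ^{r(r−1)/2} · (∏_{i=1}^r z_i^{⌊μ_i/m⌋}) · ∏_{1 ≤ i < j ≤ r} α_{−σ_i,−σ_j}. -/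
noncomputable section

/-- The horizontal spins and lower vertical edges of a row are forced by its upper edges
when the color `c` leaving the row occurs above it only in the leftmost occupied column. -/
lemma row_forced {m N M : ℕ} (hM : M < N) (c : ZMod m) (h : Fin (N + 1) → Spin m)
    (t b : Fin N → Bool) (hl : h (Fin.last N) = none) (h0 : h 0 = some c)
    (hle : ∀ k, t k = true → (k : ℕ) ≤ M)
    (hc : ∀ k, t k = true → colC m k = c → (k : ℕ) = M)
    (hadm : ∀ k : Fin N, Adm m (colC m k) (h k.succ) (if t k then some (colC m k) else none)
      (h k.castSucc) (if b k then some (colC m k) else none)) :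
    (∀ p, h p = if (p : ℕ) ≤ M then some c else none) ∧
      ∀ k, b k = (t k && decide ((k : ℕ) ≠ M)) := by
  have right : ∀ p (hp : p < N + 1), p ≤ M → h ⟨p, hp⟩ = some c := by
    intro p
    induction p with
    | zero => intro _ _; exact h0
    | succ p ih =>
      intro hp hpM
      have e := ih (by omega) (by omega)
      have ha := hadm ⟨p, by omega⟩
      have hc' := hc ⟨p, by omega⟩
      simp only [Fin.succ_mk, Fin.castSucc_mk, e] at ha hc'
      rcases ha with ha | ⟨i, ha⟩ | ha | ⟨i, ha⟩ | ha | ha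
      · simp at ha
      · exact ha.1.trans ha.2.2.1.symm
      · simp at ha
      · exact ha.1.trans ha.2.2.1.symm
      · simp at ha
      · have h1 : t ⟨p, by omega⟩ = true := by
          by_contra h1
          simp [h1] at ha
        have h2 : c = colC m p := by simpa using ha.2.2.1
        have := hc' h1 h2.symm
        omega
  have left : ∀ d p (hp : p < N + 1), p + d = N → M < p → h ⟨p, hp⟩ = none := by
    intro d
    induction d with
    | zero =>
      intro p hp hd _
      obtain rfl : p = N := by omega
      exact hl
    | succ d ih =>
      intro p hp hd hMp
      have e := ih (p + 1) (by omega) (by omega) (by omega)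
      have ha := hadm ⟨p, by omega⟩
      have ht : t ⟨p, by omega⟩ = false := by
        by_contra h1
        have := hle ⟨p, by omega⟩ (by simpa using h1)
        simp only at this
        omega
      simp only [Fin.succ_mk, Fin.castSucc_mk, e, ht] at ha
      rcases ha with ha | ⟨i, ha⟩ | ha | ⟨i, ha⟩ | ha | ha
      · exact ha.2.2.1
      all_goals simp at ha
  have hh : ∀ p, h p = if (p : ℕ) ≤ M then some c else none := by
    intro p
    split_ifs with hp
    · exact right p p.2 hp
    · exact left (N - p) p p.2 (by omega) (by omega)
  refine ⟨hh, fun k => ?_⟩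
  have ha := hadm k
  rw [hh, hh] at ha
  simp only [Fin.val_succ, Fin.val_castSucc] at ha
  rcases lt_trichotomy (k : ℕ) M with hk | hk | hk
  · rw [if_pos (show (k : ℕ) + 1 ≤ M by omega),
      if_pos (show (k : ℕ) ≤ M by omega)] at ha
    cases ht : t k <;> cases hb : b k <;> simp_all [Adm]
    omega
  · rw [if_neg (show ¬(k : ℕ) + 1 ≤ M by omega),
      if_pos (show (k : ℕ) ≤ M by omega)] at ha
    cases ht : t k <;> cases hb : b k <;> simp_all [Adm]
  · rw [if_neg (show ¬(k : ℕ) + 1 ≤ M by omega),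
      if_neg (show ¬(k : ℕ) ≤ M by omega)] at ha
    have ht : t k = false := by
      by_contra h1
      have := hle k (by simpa using h1)
      omega
    cases hb : b k <;> simp_all [Adm]

/-- The state in which, in row `i`, the path from column `μ i` turns right and leaves the
grid, while the paths of later rows go straight down. -/
def monoState {m r : ℕ} (N : ℕ) (μ : Fin r → ℕ) (σ : Fin r → ZMod m) : GState m r N :=
  (fun i p => if (p : ℕ) ≤ μ i then some (σ i) else none,
   fun i k => decide (∃ l : Fin r, (i : ℕ) ≤ l ∧ μ l = k))

lemma eq_monoState {m r N : ℕ} {μ : Fin r → ℕ} (hμ : StrictAnti μ) (hμN : ∀ i, μ i < N)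
    {σ : Fin r → ZMod m} (hσdist : Function.Injective σ)
    (hσμ : ∀ i, σ i = -(μ i : ZMod m)) {s : GState m r N} (hs : IsState μ σ s) :
    s = monoState N μ σ := by
  obtain ⟨hl, h0, ht, -, hadm⟩ := hs
  have row : ∀ i : Fin r, (∀ k, s.2 i.castSucc k = (monoState N μ σ).2 i.castSucc k) →
      (∀ p, s.1 i p = (monoState N μ σ).1 i p) ∧
        ∀ k, s.2 i.succ k = (monoState N μ σ).2 i.succ k := by
    intro i hi
    have key := row_forced (hμN i) (σ i) (s.1 i) (s.2 i.castSucc) (s.2 i.succ) (hl i) (h0 i)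
      (by
        intro k hk
        rw [hi] at hk
        obtain ⟨l, hil, hlk⟩ := of_decide_eq_true hk
        rw [← hlk]
        exact hμ.antitone (by simpa using hil))
      (by
        intro k hk hc
        rw [hi] at hk
        obtain ⟨l, hil, hlk⟩ := of_decide_eq_true hk
        have : σ l = σ i := by rw [← hc, hσμ, hlk, colC]
        rw [← hlk, hσdist this])
      (hadm i)
    refine ⟨key.1, fun k => ?_⟩
    rw [key.2, hi]
    simp only [monoState, Fin.val_castSucc, Fin.val_succ]
    rw [← Bool.decide_and]
    refine decide_eq_decide.2 ⟨?_, ?_⟩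
    · rintro ⟨⟨l, hil, hlk⟩, hk⟩
      refine ⟨l, ?_, hlk⟩
      rcases hil.lt_or_eq with h | h
      · exact h
      · exact absurd (by rw [← hlk, Fin.ext h]) hk
    · rintro ⟨l, hil, hlk⟩
      have : μ l < μ i := hμ (Fin.lt_def.2 hil)
      exact ⟨⟨l, by omega, hlk⟩, by omega⟩
  have vert : ∀ n (hn : n < r + 1), ∀ k, s.2 ⟨n, hn⟩ k = (monoState N μ σ).2 ⟨n, hn⟩ k := by
    intro n
    induction n with
    | zero =>
      intro hn k
      rw [Bool.eq_iff_iff]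
      refine (ht k).trans ?_
      simp [monoState]
    | succ n ih =>
      intro hn
      exact (row ⟨n, by omega⟩ (ih (by omega))).2
  refine Prod.ext ?_ ?_
  · funext i p
    exact (row i (vert _ _)).1 p
  · funext i k
    exact vert i i.2 k

lemma isState_monoState {m r N : ℕ} {μ : Fin r → ℕ} (hμ : StrictAnti μ)
    (hμN : ∀ i, μ i < N) {σ : Fin r → ZMod m}
    (hσμ : ∀ i, σ i = -(μ i : ZMod m)) : IsState μ σ (monoState N μ σ) := by
  refine ⟨?_, ?_, ?_, ?_, ?_⟩
  · intro i
    have := hμN i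
    simp [monoState, this]
  · intro i
    simp [monoState]
  · intro k
    simp [monoState]
  · intro k
    simp only [monoState, Fin.val_last, decide_eq_false_iff_not]
    rintro ⟨l, hl, -⟩
    have := l.2
    omega
  · intro i k
    have anti : ∀ l : Fin r, (i : ℕ) ≤ l → μ l ≤ μ i := fun l h => hμ.antitone h
    have santi : ∀ l : Fin r, (i : ℕ) + 1 ≤ l → μ l < μ i := fun l h => hμ (Fin.lt_def.2 h)
    have step : ∀ l : Fin r, (i : ℕ) ≤ l → μ l < μ i → (i : ℕ) + 1 ≤ l := by
      intro l hl hlt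
      rcases hl.lt_or_eq with h | h
      · exact h
      · rw [Fin.ext h] at hlt
        exact absurd hlt (lt_irrefl _)
    simp only [vspin, monoState, Fin.val_succ, Fin.val_castSucc, decide_eq_true_eq]
    rcases lt_trichotomy (k : ℕ) (μ i) with hk | hk | hk
    · rw [if_pos (show (k : ℕ) + 1 ≤ μ i by omega),
      if_pos (show (k : ℕ) ≤ μ i by omega)]
      by_cases h : ∃ l : Fin r, (i : ℕ) + 1 ≤ l ∧ μ l = k
      · obtain ⟨l, hl, hlk⟩ := h
        rw [if_pos ⟨l, by omega, hlk⟩, if_pos ⟨l, hl, hlk⟩]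
        simp [Adm]
      · rw [if_neg h, if_neg]
        · simp [Adm]
        · rintro ⟨l, hl, hlk⟩
          exact h ⟨l, step l hl (by omega), hlk⟩
    · rw [if_neg (show ¬(k : ℕ) + 1 ≤ μ i by omega),
      if_pos (show (k : ℕ) ≤ μ i by omega), if_pos ⟨i, le_rfl, hk.symm⟩, if_neg]
      · simp [Adm, hσμ, colC, hk]
      · rintro ⟨l, hl, hlk⟩
        have := santi l hl
        omega
    · rw [if_neg (show ¬(k : ℕ) + 1 ≤ μ i by omega),
      if_neg (show ¬(k : ℕ) ≤ μ i by omega), if_neg, if_neg]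
      · simp [Adm]
      · rintro ⟨l, hl, hlk⟩
        have := santi l hl
        omega
      · rintro ⟨l, hl, hlk⟩
        have := anti l hl
        omega

lemma wt_monoState {m r N : ℕ} (q Φ : ℂ) (α : ZMod m → ZMod m → ℂ) {μ : Fin r → ℕ}
    (hμ : StrictAnti μ) {σ : Fin r → ZMod m} (hσdist : Function.Injective σ)
    (hσμ : ∀ i, σ i = -(μ i : ZMod m)) (z : ℂ) (i : Fin r) (k : Fin N) :
    wt m q Φ α (colC m k) z ((monoState N μ σ).1 i k.succ)
        (vspin (monoState N μ σ) i.castSucc k) ((monoState N μ σ).1 i k.castSucc)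
        (vspin (monoState N μ σ) i.succ k) =
      (if (k : ℕ) < μ i ∧ k ≡ μ i [MOD m] then z else 1) *
        ∏ l ∈ Finset.Ioi i, if (k : ℕ) = μ l then Φ * α (-(σ i)) (-(σ l)) else 1 := by
  have anti : ∀ l : Fin r, (i : ℕ) ≤ l → μ l ≤ μ i := fun l h => hμ.antitone h
  have santi : ∀ l : Fin r, (i : ℕ) + 1 ≤ l → μ l < μ i := fun l h => hμ (Fin.lt_def.2 h)
  have step : ∀ l : Fin r, (i : ℕ) ≤ l → μ l < μ i → (i : ℕ) + 1 ≤ l := by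
    intro l hl hlt
    rcases hl.lt_or_eq with h | h
    · exact h
    · rw [Fin.ext h] at hlt
      exact absurd hlt (lt_irrefl _)
  have hcol : ∀ l : Fin r, σ l = colC m k ↔ k ≡ μ l [MOD m] := by
    intro l
    rw [hσμ, colC, neg_inj, ZMod.natCast_eq_natCast_iff]
    exact ⟨Nat.ModEq.symm, Nat.ModEq.symm⟩
  simp only [vspin, monoState, Fin.val_succ, Fin.val_castSucc, decide_eq_true_eq]
  by_cases h : ∃ l : Fin r, (i : ℕ) + 1 ≤ l ∧ μ l = k
  · obtain ⟨l, hl, hlk⟩ := h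
    have hlt := santi l hl
    have hσl : σ l = colC m k := (hcol l).2 (by rw [hlk])
    have hne : σ i ≠ colC m k := fun e => by
      have := hσdist (e.trans hσl.symm)
      rw [this] at hl
      omega
    rw [if_pos (show (k : ℕ) + 1 ≤ μ i by omega),
      if_pos (show (k : ℕ) ≤ μ i by omega), if_pos ⟨l, by omega, hlk⟩,
      if_pos ⟨l, hl, hlk⟩, if_neg (fun e => hne ((hcol i).2 e.2)), one_mul,
      Finset.prod_eq_single l]
    · simp [wt, hne, hlk, hσl]
    · intro b _ hb
      exact if_neg fun e => hb (hμ.injective (by rw [← e, hlk]))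
    · intro hl'
      exact absurd (Finset.mem_Ioi.2 (Fin.lt_def.2 hl)) hl'
  · have hprod : (∏ l ∈ Finset.Ioi i,
        if (k : ℕ) = μ l then Φ * α (-(σ i)) (-(σ l)) else 1) = 1 := by
      refine Finset.prod_eq_one fun l hl => if_neg fun e => h ⟨l, ?_, e.symm⟩
      exact Fin.lt_def.1 (Finset.mem_Ioi.1 hl)
    rw [hprod, mul_one, if_neg h]
    rcases lt_trichotomy (k : ℕ) (μ i) with hk | hk | hk
    · rw [if_pos (show (k : ℕ) + 1 ≤ μ i by omega),
      if_pos (show (k : ℕ) ≤ μ i by omega), if_neg]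
      · simp [wt, hk, hcol]
      · rintro ⟨l, hl, hlk⟩
        exact h ⟨l, step l hl (by omega), hlk⟩
    · have hσi : σ i = colC m k := (hcol i).2 (by rw [hk])
      rw [if_neg (show ¬(k : ℕ) + 1 ≤ μ i by omega),
      if_pos (show (k : ℕ) ≤ μ i by omega), if_pos ⟨i, le_rfl, hk.symm⟩,
        if_neg (fun e => hk.not_lt e.1)]
      simp [wt, hσi]
    · rw [if_neg (show ¬(k : ℕ) + 1 ≤ μ i by omega),
      if_neg (show ¬(k : ℕ) ≤ μ i by omega), if_neg, if_neg (fun e => hk.not_gt e.1)]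
      · simp [wt]
      · rintro ⟨l, hl, hlk⟩
        have := anti l hl
        omega

lemma prod_ite_modEq_self {m N M : ℕ} (hm : 0 < m) (hM : M < N) (z : ℂ) :
    (∏ k : Fin N, if (k : ℕ) < M ∧ k ≡ M [MOD m] then z else 1) = z ^ (M / m) := by
  rw [Fin.prod_univ_eq_prod_range (fun k => if k < M ∧ k ≡ M [MOD m] then z else 1) N,
    ← Finset.prod_filter, Finset.prod_const]
  congr 1
  have hcount := Nat.count_modEq_card M hm M
  rw [if_neg (lt_irrefl _), add_zero, Nat.count_eq_card_filter_range] at hcount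
  rw [← hcount]
  congr 1
  ext k
  simp only [Finset.mem_filter, Finset.mem_range]
  constructor
  · rintro ⟨_, h1, h2⟩
    exact ⟨h1, h2⟩
  · rintro ⟨h1, h2⟩
    exact ⟨by omega, h1, h2⟩

lemma swt_monoState {m r N : ℕ} (hm : 0 < m) (q Φ : ℂ) (α : ZMod m → ZMod m → ℂ)
    {μ : Fin r → ℕ} (hμ : StrictAnti μ) (hμN : ∀ i, μ i < N) {σ : Fin r → ZMod m}
    (hσdist : Function.Injective σ) (hσμ : ∀ i, σ i = -(μ i : ZMod m)) (z : Fin r → ℂ) :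
    swt q Φ α z (monoState N μ σ) =
      Φ ^ (r * (r - 1) / 2) * (∏ i, z i ^ (μ i / m)) *
        ∏ p ∈ Finset.univ.filter (fun p : Fin r × Fin r => p.1 < p.2),
          α (-(σ p.1)) (-(σ p.2)) := by
  have hrow : ∀ i : Fin r, (∏ k : Fin N, ∏ l ∈ Finset.Ioi i,
      if (k : ℕ) = μ l then Φ * α (-(σ i)) (-(σ l)) else 1) =
        Φ ^ (r - 1 - (i : ℕ)) * ∏ l ∈ Finset.Ioi i, α (-(σ i)) (-(σ l)) := by
    intro i
    rw [Finset.prod_comm, ← Fin.card_Ioi, ← Finset.prod_const, ← Finset.prod_mul_distrib]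
    refine Finset.prod_congr rfl fun l _ => ?_
    rw [Finset.prod_eq_single (⟨μ l, hμN l⟩ : Fin N)]
    · simp
    · exact fun k _ hk => if_neg fun e => hk (Fin.ext e)
    · exact fun h => absurd (Finset.mem_univ _) h
  have hpairs : (∏ p ∈ Finset.univ.filter (fun p : Fin r × Fin r => p.1 < p.2),
      α (-(σ p.1)) (-(σ p.2))) = ∏ i, ∏ l ∈ Finset.Ioi i, α (-(σ i)) (-(σ l)) := by
    rw [Finset.prod_filter, ← Finset.univ_product_univ, Finset.prod_product]
    refine Finset.prod_congr rfl fun i _ => ?_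
    rw [← Finset.prod_filter]
    refine Finset.prod_congr ?_ fun _ _ => rfl
    ext l
    simp
  have hΦ : ∏ i : Fin r, Φ ^ (r - 1 - (i : ℕ)) = Φ ^ (r * (r - 1) / 2) := by
    rw [Finset.prod_pow_eq_pow_sum, Fin.sum_univ_eq_sum_range (fun i => r - 1 - i) r,
      Finset.sum_range_reflect (fun i => i) r, Finset.sum_range_id]
  simp only [swt, wt_monoState q Φ α hμ hσdist hσμ, Finset.prod_mul_distrib, hrow, hpairs,
    hΦ, prod_ite_modEq_self hm (hμN _)]
  ring

/-- monostatic systems: if `σ` has pairwise distinct components and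
`σ_i ≡ −μ_i (mod m)` for all `i`, then `𝔖^m_{μ,σ}` has exactly one admissible state, and
`Z(𝔖^m_{μ,σ})(z) = Φ^{r(r−1)/2} · ∏_i z_i^{⌊μ_i/m⌋} · ∏_{i<j} α_{−σ_i,−σ_j}`. -/
theorem monostatic_partition_function
    (m : ℕ) [NeZero m] (r N : ℕ) (q Φ : ℂ) (hq : q ≠ 0) (hΦ : Φ ≠ 0)
    (α : ZMod m → ZMod m → ℂ) (hα : ∀ x y, α x y * α y x = 1) (hα1 : ∀ x, α x x = 1)
    (μ : Fin r → ℕ) (hμ : StrictAnti μ) (hμN : ∀ i, μ i < N)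
    (σ : Fin r → ZMod m) (hσdist : Function.Injective σ)
    (hσμ : ∀ i, σ i = -(μ i : ZMod m)) :
    (∃! s : GState m r N, IsState μ σ s) ∧
      ∀ z : Fin r → ℂ, (∀ i, z i ≠ 0) →
        Z m r N q Φ α μ σ z =
          Φ ^ (r * (r - 1) / 2) * (∏ i, z i ^ (μ i / m)) *
            ∏ p ∈ Finset.univ.filter (fun p : Fin r × Fin r => p.1 < p.2),
              α (-(σ p.1)) (-(σ p.2)) := by
  have hs := isState_monoState (m := m) hμ hμN hσμ
  have huniq := fun s => eq_monoState (s := s) hμ hμN hσdist hσμ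
  refine ⟨⟨_, hs, huniq⟩, fun z _ => ?_⟩
  rw [Z, Finset.sum_eq_single (monoState N μ σ), if_pos hs,
    swt_monoState (NeZero.pos m) q Φ α hμ hμN hσdist hσμ z]
  · exact fun s _ hne => if_neg fun h => hne (huniq s h)
  · exact fun h => absurd (Finset.mem_univ _) h
end
end

section
/- Demazure recursion for partition functions: Let 1 ≤ i ≤ r−1 and suppose σ_i ≠ σ_{i+1} in ℤ/mℤ. Then for all (z_1,…,z_r) ∈ (ℂ*)^r with z_i ≠ z_{i+1}: Z(𝔖^m_{μ,s_iσ})(z) = (q^{−1}·α_{−σ_{i+1},−σ_i} / (1 − z_i/z_{i+1})) · [ (q²·z_i/z_{i+1} − 1)·Z(𝔖^m_{μ,σ})(s_i z) + (1 − q²)·κ·Z(𝔖^m_{μ,σ})(z) ], where κ = 1 if σ_i > σ_{i+1} and κ = z_i/z_{i+1} if σ_i < σ_{i+1} (comparing representatives in {1,…,m}), s_iσ is σ with components i and i+1 exchanged, and s_i z is z with z_i and z_{i+1} exchanged. -/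
noncomputable section

/-- The spin of a vertical edge in a column of color `j`, from its occupancy. -/
def edgeSpin {m : ℕ} (j : ZMod m) (t : Bool) : Spin m := if t then some j else none

lemma wt_eq_zero_of_not_adm {m : ℕ} {q Φ : ℂ} {α : ZMod m → ZMod m → ℂ} {j : ZMod m} {z : ℂ}
    {a c : Spin m} {t u : Bool} (h : ¬ Adm m j a (edgeSpin j t) c (edgeSpin j u)) :
    wt m q Φ α j z a (edgeSpin j t) c (edgeSpin j u) = 0 := by
  rcases a with _ | a <;> rcases c with _ | c <;> cases t <;> cases u <;>
    simp_all [Adm, wt, edgeSpin, eq_comm]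

/-- The one-vertex transfer map: the sum over the left spin `b` of the vertex weight times `f b`,
for prescribed right spin and prescribed occupancies of the top and bottom edges. -/
def vertexSum {m : ℕ} (q Φ : ℂ) (α : ZMod m → ZMod m → ℂ) (j : ZMod m) (z : ℂ) :
    Spin m → Bool → Bool → (Spin m → ℂ) → ℂ
  | none, false, false, f => f none
  | none, false, true, f => -(Φ / q) * (1 - q ^ 2) * z * f (some j)
  | none, true, false, _ => 0
  | none, true, true, f => -Φ / q * f none
  | some i, false, false, f => (if i = j then z else 1) * f (some i)
  | some _, false, true, _ => 0
  | some i, true, false, f => if i = j then f none else 0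
  | some i, true, true, f => (if i = j then Φ * q * z else Φ * α (-i) (-j)) * f (some i)

lemma sum_wt_mul {m : ℕ} [NeZero m] (q Φ : ℂ) (α : ZMod m → ZMod m → ℂ) (j : ZMod m) (z : ℂ)
    (c : Spin m) (t u : Bool) (f : Spin m → ℂ) :
    ∑ b, wt m q Φ α j z b (edgeSpin j t) c (edgeSpin j u) * f b =
      vertexSum q Φ α j z c t u f := by
  rw [Fintype.sum_option]
  rcases c with _ | c <;> cases t <;> cases u <;>
    simp [wt, edgeSpin, vertexSum, ite_mul]

/-- The two-row, one-column transfer map: sum over the left spins of both rows and over the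
middle vertical edge. -/
def columnMap {m : ℕ} (q Φ : ℂ) (α : ZMod m → ZMod m → ℂ) (j : ZMod m) (z₁ z₂ : ℂ) (t u : Bool)
    (p : Spin m → Spin m → ℂ) (a₁ a₂ : Spin m) : ℂ :=
  ∑ d : Bool, vertexSum q Φ α j z₁ a₁ t d fun b₁ => vertexSum q Φ α j z₂ a₂ d u (p b₁)

/-- The action of the R-vertex attached to the order relation `L` on the colors. -/
def rMap {m : ℕ} (q Φ : ℂ) (α : ZMod m → ZMod m → ℂ) (z₁ z₂ : ℂ) (L : ZMod m → ZMod m → Prop)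
    [DecidableRel L] (p : Spin m → Spin m → ℂ) : Spin m → Spin m → ℂ
  | none, none => (q ^ 2 * z₁ - z₂) * p none none
  | none, some c =>
      (q ^ 2 - 1) * z₂ * p none (some c) + Φ * q * (z₂ - z₁) * p (some c) none
  | some c, none =>
      (q ^ 2 - 1) * z₁ * p (some c) none + q / Φ * (z₂ - z₁) * p none (some c)
  | some a, some b =>
      if a = b then (q ^ 2 * z₂ - z₁) * p (some a) (some a)
      else (q ^ 2 - 1) * (if L a b then z₁ else z₂) * p (some a) (some b) +
        q * (z₂ - z₁) * α (-a) (-b) * p (some b) (some a)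

/-- The Yang–Baxter equation: moving an R-vertex past a column of color `j` turns `j` from the
smallest color into the largest one. -/
lemma columnMap_rMap {m : ℕ} {q Φ : ℂ} (hq : q ≠ 0) (hΦ : Φ ≠ 0)
    {α : ZMod m → ZMod m → ℂ} (hα : ∀ x y, α x y * α y x = 1)
    {j : ZMod m} {z₁ z₂ : ℂ} {L L' : ZMod m → ZMod m → Prop} [DecidableRel L] [DecidableRel L']
    (hmin : ∀ a, a ≠ j → L' j a ∧ ¬ L' a j) (hmax : ∀ a, a ≠ j → L a j ∧ ¬ L j a)
    (hLL : ∀ a b, a ≠ j → b ≠ j → (L a b ↔ L' a b))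
    (t u : Bool) (p : Spin m → Spin m → ℂ) (a b : Spin m) :
    columnMap q Φ α j z₂ z₁ t u (rMap q Φ α z₁ z₂ L' p) a b =
      rMap q Φ α z₁ z₂ L (columnMap q Φ α j z₁ z₂ t u p) a b := by
  have hα' : ∀ x y, α x y ≠ 0 := fun x y => left_ne_zero_of_mul_eq_one (hα x y)
  have hinv : ∀ x y, α x y = (α y x)⁻¹ := fun x y => eq_inv_of_mul_eq_one_left (hα x y)
  rcases a with _ | a <;> rcases b with _ | b
  · cases t <;> cases u <;> simp [columnMap, vertexSum, rMap] <;> field_simp <;> ring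
  · by_cases hb : b = j
    · subst hb
      cases t <;> cases u <;> simp [columnMap, vertexSum, rMap] <;> field_simp <;> ring
    · cases t <;> cases u <;> simp [columnMap, vertexSum, rMap, hb, Ne.symm hb, hmin b hb] <;>
        (try rw [hinv (-j) (-b)]) <;> (have := hα' (-b) (-j)) <;> field_simp <;> ring
  · by_cases hb : a = j
    · subst hb
      cases t <;> cases u <;> simp [columnMap, vertexSum, rMap] <;> field_simp <;> ring
    · cases t <;> cases u <;> simp [columnMap, vertexSum, rMap, hb, hmin a hb] <;>
        field_simp <;> ring
  · by_cases hab : a = b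
    · subst hab
      by_cases ha : a = j
      · subst ha
        cases t <;> cases u <;> simp [columnMap, vertexSum, rMap] <;> field_simp <;> ring
      · cases t <;> cases u <;> simp [columnMap, vertexSum, rMap, ha] <;> ring
    by_cases ha : a = j
    · subst ha
      have hb := Ne.symm hab
      cases t <;> cases u <;>
        simp [columnMap, vertexSum, rMap, hab, hb, hmin b hb, hmax b hb] <;>
        (try rw [hinv (-a) (-b)]) <;> (have := hα' (-b) (-a)) <;> field_simp
    by_cases hb : b = j
    · subst hb
      cases t <;> cases u <;>
        simp [columnMap, vertexSum, rMap, hab, hmin a hab, hmax a hab] <;>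
        field_simp
    · by_cases h : L' a b <;> cases t <;> cases u <;>
        simp [columnMap, vertexSum, rMap, hab, ha, hb, hLL a b ha hb, h] <;> ring

lemma columnMap_const_mul {m : ℕ} (q Φ : ℂ) (α : ZMod m → ZMod m → ℂ) (j : ZMod m) (z₁ z₂ : ℂ)
    (t u : Bool) (c : ℂ) (p : Spin m → Spin m → ℂ) (a b : Spin m) :
    columnMap q Φ α j z₁ z₂ t u (fun x y => c * p x y) a b =
      c * columnMap q Φ α j z₁ z₂ t u p a b := by
  have key : ∀ (z : ℂ) (a : Spin m) (t u : Bool) (f : Spin m → ℂ),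
      vertexSum q Φ α j z a t u (fun x => c * f x) = c * vertexSum q Φ α j z a t u f := by
    intro z a t u f
    rcases a with _ | a <;> cases t <;> cases u <;> simp [vertexSum, mul_left_comm]
  simp only [columnMap, key, Finset.mul_sum]

/-- The partition function of a single row whose columns have colors `J`, with left spin `+`,
right spin `c` and prescribed vertical edges above and below. -/
def rowZ {m : ℕ} [NeZero m] (q Φ : ℂ) (α : ZMod m → ZMod m → ℂ) {N : ℕ} (J : Fin N → ZMod m)
    (z : ℂ) (c : Spin m) (t u : Fin N → Bool) : ℂ :=
  ∑ h : Fin (N + 1) → Spin m, if h (Fin.last N) = none ∧ h 0 = c then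
    ∏ k : Fin N, wt m q Φ α (J k) z (h k.succ) (edgeSpin (J k) (t k)) (h k.castSucc)
      (edgeSpin (J k) (u k)) else 0

/-- The partition function of two consecutive rows. -/
def twoRowZ {m : ℕ} [NeZero m] (q Φ : ℂ) (α : ZMod m → ZMod m → ℂ) {N : ℕ} (J : Fin N → ZMod m)
    (z₁ z₂ : ℂ) (t u : Fin N → Bool) (a b : Spin m) : ℂ :=
  ∑ x : Fin N → Bool, rowZ q Φ α J z₁ a t x * rowZ q Φ α J z₂ b x u

section Rows

variable {m : ℕ} [NeZero m] (q Φ : ℂ) (α : ZMod m → ZMod m → ℂ)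

lemma rowZ_zero (J : Fin 0 → ZMod m) (z : ℂ) (c : Spin m) (t u : Fin 0 → Bool) :
    rowZ q Φ α J z c t u = if c = none then 1 else 0 := by
  rw [rowZ, ← (Equiv.funUnique (Fin 1) (Spin m)).symm.sum_comp]
  have h : ∀ x : Spin m, (x = none ∧ x = c) ↔ x = none ∧ c = none := by
    rintro x
    constructor <;> rintro ⟨rfl, rfl⟩ <;> simp
  simp [h, ite_and]

lemma rowZ_succ {N : ℕ} (J : Fin (N + 1) → ZMod m) (z : ℂ) (c : Spin m)
    (t u : Fin (N + 1) → Bool) :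
    rowZ q Φ α J z c t u = vertexSum q Φ α (J 0) z c (t 0) (u 0)
      fun b => rowZ q Φ α (Fin.tail J) z b (Fin.tail t) (Fin.tail u) := by
  rw [← sum_wt_mul, rowZ, ← (Fin.consEquiv fun _ => Spin m).sum_comp, Fintype.sum_prod_type]
  rw [Finset.sum_eq_single c]
  · simp only [rowZ, Finset.mul_sum]
    rw [Finset.sum_comm]
    refine Finset.sum_congr rfl fun h _ => ?_
    rw [Finset.sum_eq_single (h 0)]
    · simp [Fin.prod_univ_succ, ← Fin.succ_last, Fin.tail, Fin.consEquiv]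
    · intro b _ hb
      simp [hb.symm]
    · simp
  · intro b _ hb
    simp [hb, Fin.consEquiv]
  · simp

lemma twoRowZ_succ {N : ℕ} (J : Fin (N + 1) → ZMod m) (z₁ z₂ : ℂ) (t u : Fin (N + 1) → Bool)
    (a b : Spin m) :
    twoRowZ q Φ α J z₁ z₂ t u a b = columnMap q Φ α (J 0) z₁ z₂ (t 0) (u 0)
      (twoRowZ q Φ α (Fin.tail J) z₁ z₂ (Fin.tail t) (Fin.tail u)) a b := by
  rw [twoRowZ, ← (Fin.consEquiv fun _ => Bool).sum_comp, Fintype.sum_prod_type, columnMap]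
  refine Finset.sum_congr rfl fun d _ => ?_
  simp only [rowZ_succ, ← sum_wt_mul, twoRowZ, Finset.mul_sum, Finset.sum_mul]
  simp only [Fin.consEquiv, Equiv.coe_fn_mk, Fin.cons_zero, Fin.tail_cons]
  rw [Finset.sum_comm]
  rw [Finset.sum_congr rfl fun _ _ => Finset.sum_comm, Finset.sum_comm]
  refine Finset.sum_congr rfl fun _ _ => Finset.sum_congr rfl fun _ _ =>
    Finset.sum_congr rfl fun _ _ => by ring

end Rows

lemma rep_le (m : ℕ) [NeZero m] (x : ZMod m) : rep m x ≤ m := ZMod.val_lt _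

lemma rep_zero (m : ℕ) [NeZero m] : rep m 0 = m := by
  obtain ⟨n, rfl⟩ := Nat.exists_eq_succ_of_ne_zero (NeZero.ne m)
  simp [rep, ZMod.val_neg_one]

lemma rep_injective (m : ℕ) [NeZero m] : Function.Injective (rep m) := fun _ _ h =>
  sub_left_injective (ZMod.val_injective m (Nat.succ_injective h))

lemma rep_add_one {m : ℕ} [NeZero m] {x : ZMod m} (hx : x ≠ 0) : rep m (x + 1) = rep m x + 1 := by
  have hcast : ((rep m x : ℕ) : ZMod m) = x := by simp [rep]
  have hlt : rep m x < m := lt_of_le_of_ne (rep_le m x) fun h => hx (by rw [← hcast, h]; simp)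
  rw [rep, add_sub_cancel_right, ← ZMod.val_cast_of_lt hlt, hcast]

lemma rep_zero_add_one (m : ℕ) [NeZero m] : rep m (0 + 1) = 1 := by simp [rep]

lemma one_le_rep (m : ℕ) (x : ZMod m) : 1 ≤ rep m x := Nat.le_add_left _ _

lemma twoRowZ_exchange {m : ℕ} [NeZero m] {q Φ : ℂ} (hq : q ≠ 0) (hΦ : Φ ≠ 0)
    {α : ZMod m → ZMod m → ℂ} (hα : ∀ x y, α x y * α y x = 1) (z₁ z₂ : ℂ) (N o : ℕ)
    (t u : Fin N → Bool) (a b : Spin m) :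
    (q ^ 2 * z₁ - z₂) * twoRowZ q Φ α (fun k : Fin N => colC m (k + o)) z₂ z₁ t u a b =
      rMap q Φ α z₁ z₂ (fun x y => rep m (x + o) < rep m (y + o))
        (twoRowZ q Φ α (fun k : Fin N => colC m (k + o)) z₁ z₂ t u) a b := by
  induction N generalizing o a b with
  | zero =>
    rcases a with _ | a <;> rcases b with _ | b <;> simp [rMap, twoRowZ, rowZ_zero]
  | succ N ih =>
    have htail : Fin.tail (fun k : Fin (N + 1) => colC m (k + o)) =
        fun k : Fin N => colC m (k + (o + 1)) := by
      funext k
      simp [Fin.tail, add_assoc, add_comm 1 o]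
    have hsucc : twoRowZ q Φ α (fun k : Fin (N + 1) => colC m (k + o)) z₁ z₂ t u =
        columnMap q Φ α (colC m o) z₁ z₂ (t 0) (u 0)
          (twoRowZ q Φ α (fun k : Fin N => colC m (k + (o + 1))) z₁ z₂ (Fin.tail t)
            (Fin.tail u)) := by
      funext a b
      rw [twoRowZ_succ, htail]
      simp
    rw [hsucc, twoRowZ_succ, htail, ← columnMap_const_mul]
    simp only [ih]
    have hne : ∀ {x : ZMod m}, x ≠ colC m o → x + o ≠ 0 := fun hx h =>
      hx (eq_neg_of_add_eq_zero_left h)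
    have hcol : colC m o + o = 0 := neg_add_cancel _
    have hlt : ∀ {x : ZMod m}, x ≠ 0 → rep m x < m := fun {x} hx =>
      lt_of_le_of_ne (rep_le m x) fun h => hx (rep_injective m (h.trans (rep_zero m).symm))
    simp only [Fin.val_zero, zero_add]
    refine columnMap_rMap hq hΦ hα ?_ ?_ ?_ _ _ _ _ _
    · intro x hx
      have h1 := one_le_rep m (x + o)
      simp only [Nat.cast_add, Nat.cast_one, ← add_assoc, hcol, rep_zero_add_one,
        rep_add_one (hne hx)]
      omega
    · intro x hx
      have h1 := hlt (hne hx)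
      rw [hcol, rep_zero]
      omega
    · intro x y hx hy
      simp only [Nat.cast_add, Nat.cast_one, ← add_assoc, rep_add_one (hne hx),
        rep_add_one (hne hy)]
      omega

/-- The partition function as a sum over the configurations of vertical edges. -/
lemma Z_eq_sum_prod_rowZ (m : ℕ) [NeZero m] (r N : ℕ) (q Φ : ℂ) (α : ZMod m → ZMod m → ℂ)
    (μ : Fin r → ℕ) (σ : Fin r → ZMod m) (z : Fin r → ℂ) :
    Z m r N q Φ α μ σ z = ∑ v : Fin (r + 1) → Fin N → Bool,
      if v 0 = (fun k : Fin N => decide (∃ i, μ i = k)) ∧ v (Fin.last r) = (fun _ => false) then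
        ∏ i : Fin r, rowZ q Φ α (fun k : Fin N => colC m k) (z i) (some (σ i)) (v i.castSucc)
          (v i.succ)
      else 0 := by
  classical
  rw [Z, Fintype.sum_prod_type_right]
  refine Finset.sum_congr rfl fun v _ => ?_
  have h0 : (v 0 = fun k : Fin N => decide (∃ i, μ i = k)) ↔
      ∀ k : Fin N, (v 0 k = true ↔ ∃ i, μ i = (k : ℕ)) := by
    rw [funext_iff]
    refine forall_congr' fun k => ?_
    rw [Bool.eq_iff_iff, decide_eq_true_iff]
  have h1 : (v (Fin.last r) = fun _ => false) ↔ ∀ k, v (Fin.last r) k = false := funext_iff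
  simp only [h0, h1]
  split_ifs with hv
  · simp only [rowZ]
    rw [Finset.prod_univ_sum, Fintype.piFinset_univ]
    refine Finset.sum_congr rfl fun h _ => ?_
    by_cases hb : ∀ i, h i (Fin.last N) = none ∧ h i 0 = some (σ i)
    · simp only [hb, and_self, if_true]
      by_cases hA : ∀ (i : Fin r) (k : Fin N), Adm m (colC m k) (h i k.succ)
          (edgeSpin (colC m k) (v i.castSucc k)) (h i k.castSucc)
          (edgeSpin (colC m k) (v i.succ k))
      · rw [if_pos ⟨fun i => (hb i).1, fun i => (hb i).2, hv.1, hv.2, hA⟩]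
        rfl
      · rw [if_neg fun hs => hA hs.2.2.2.2]
        push Not at hA
        obtain ⟨i, k, hik⟩ := hA
        exact (Finset.prod_eq_zero (Finset.mem_univ i) (Finset.prod_eq_zero (Finset.mem_univ k)
          (wt_eq_zero_of_not_adm hik))).symm
    · rw [if_neg fun hs => hb fun i => ⟨hs.1 i, hs.2.1 i⟩]
      push Not at hb
      obtain ⟨i, hi⟩ := hb
      exact (Finset.prod_eq_zero (Finset.mem_univ i) (if_neg fun h => hi h.1 h.2)).symm
  · exact Finset.sum_eq_zero fun h _ => if_neg fun hs => hv ⟨hs.2.2.1, hs.2.2.2.1⟩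

/-- Isolating two consecutive rows: the contribution `C` of the remaining rows does not depend on
the parameters of the two chosen rows. -/
lemma exists_Z_eq_sum_twoRowZ (m : ℕ) [NeZero m] (r N : ℕ) (q Φ : ℂ) (α : ZMod m → ZMod m → ℂ)
    (μ : Fin r → ℕ) {i j : Fin r} (hij : (i : ℕ) + 1 = j) (σ₀ : Fin r → ZMod m) (z₀ : Fin r → ℂ) :
    ∃ (C : ({k : Fin (r + 1) // k ≠ i.succ} → Fin N → Bool) → ℂ)
      (t u : ({k : Fin (r + 1) // k ≠ i.succ} → Fin N → Bool) → Fin N → Bool),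
      ∀ (σ : Fin r → ZMod m) (z : Fin r → ℂ),
        (∀ k, k ≠ i → k ≠ j → σ k = σ₀ k ∧ z k = z₀ k) →
        Z m r N q Φ α μ σ z = ∑ w, C w *
          twoRowZ q Φ α (fun k : Fin N => colC m (k + 0)) (z i) (z j) (t w) (u w)
            (some (σ i)) (some (σ j)) := by
  classical
  have hne : i ≠ j := fun h => by subst h; omega
  have hmid : j.castSucc = i.succ := Fin.ext (by simp [hij])
  have htop : i.castSucc ≠ i.succ := fun h => by simp [Fin.ext_iff] at h
  have hbot : j.succ ≠ i.succ := fun h => hne (Fin.succ_injective _ h).symm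
  have hfirst : (0 : Fin (r + 1)) ≠ i.succ := (Fin.succ_ne_zero i).symm
  have hlast : Fin.last r ≠ i.succ := fun h => by
    have := congrArg Fin.val h
    simp at this
    omega
  refine ⟨fun w =>
    if w ⟨0, hfirst⟩ = (fun k : Fin N => decide (∃ i, μ i = k)) ∧
        w ⟨Fin.last r, hlast⟩ = (fun _ => false) then
      ∏ k ∈ (Finset.univ.erase i).erase j, rowZ q Φ α (fun k : Fin N => colC m k) (z₀ k)
        (some (σ₀ k)) ((Equiv.funSplitAt i.succ _).symm (fun _ => false, w) k.castSucc)
        ((Equiv.funSplitAt i.succ _).symm (fun _ => false, w) k.succ) else 0,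
    fun w => w ⟨_, htop⟩, fun w => w ⟨_, hbot⟩, fun σ z h => ?_⟩
  rw [Z_eq_sum_prod_rowZ, ← (Equiv.funSplitAt i.succ _).symm.sum_comp,
    Fintype.sum_prod_type_right]
  refine Finset.sum_congr rfl fun w _ => ?_
  rw [twoRowZ, Finset.mul_sum]
  refine Finset.sum_congr rfl fun x _ => ?_
  have e : ∀ {k : Fin (r + 1)} (hk : k ≠ i.succ) (x : Fin N → Bool),
      (Equiv.funSplitAt i.succ (Fin N → Bool)).symm (x, w) k = w ⟨k, hk⟩ := fun hk x => by
    simp [Equiv.funSplitAt, Equiv.piSplitAt, hk]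
  have e' : (Equiv.funSplitAt i.succ (Fin N → Bool)).symm (x, w) i.succ = x := by
    simp [Equiv.funSplitAt, Equiv.piSplitAt]
  rw [e hfirst, e hlast, ite_mul, zero_mul]
  refine if_congr Iff.rfl ?_ rfl
  rw [← Finset.mul_prod_erase _ _ (Finset.mem_univ i), ← Finset.mul_prod_erase _ _
    (Finset.mem_erase.2 ⟨hne.symm, Finset.mem_univ j⟩), hmid, e htop, e hbot, e', ← mul_assoc,
    mul_comm]
  simp only [add_zero]
  refine congrArg (· * _) (Finset.prod_congr rfl fun k hk => ?_)
  have hkj := (Finset.mem_erase.1 hk).1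
  have hki := (Finset.mem_erase.1 (Finset.mem_erase.1 hk).2).1
  have hk1 : k.castSucc ≠ i.succ := fun h => hkj (Fin.castSucc_injective _ (h.trans hmid.symm))
  have hk2 : k.succ ≠ i.succ := fun h => hki (Fin.succ_injective _ h)
  rw [(h k hki hkj).1, (h k hki hkj).2, e hk1, e hk2, e hk1, e hk2]

/-- Demazure recursion: for an adjacent pair of rows `i, i + 1` with
`σ_i ≠ σ_{i+1}`, the partition function with `σ_i, σ_{i+1}` exchanged is expressed
through a Demazure-type divided difference operator applied to the original one. -/
theorem demazure_recursion
    (m : ℕ) [NeZero m] (r N : ℕ) (q Φ : ℂ) (hq : q ≠ 0) (hΦ : Φ ≠ 0)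
    (α : ZMod m → ZMod m → ℂ) (hα : ∀ x y, α x y * α y x = 1) (hα1 : ∀ x, α x x = 1)
    (μ : Fin r → ℕ) (hμ : StrictAnti μ) (hμN : ∀ i, μ i < N)
    (σ : Fin r → ZMod m)
    (ii jj : Fin r) (hadj : (ii : ℕ) + 1 = (jj : ℕ))
    (hσ : σ ii ≠ σ jj)
    (z : Fin r → ℂ) (hz : ∀ i, z i ≠ 0) (hzz : z ii ≠ z jj) :
    Z m r N q Φ α μ (σ ∘ Equiv.swap ii jj) z =
      q⁻¹ * α (-(σ jj)) (-(σ ii)) / (1 - z ii / z jj) *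
        ((q ^ 2 * z ii / z jj - 1) * Z m r N q Φ α μ σ (z ∘ Equiv.swap ii jj) +
          (1 - q ^ 2) *
            (if rep m (σ jj) < rep m (σ ii) then 1 else z ii / z jj) *
            Z m r N q Φ α μ σ z) := by
  have hne : ii ≠ jj := fun h => hσ (h ▸ rfl)
  have off : ∀ k, k ≠ ii → k ≠ jj → Equiv.swap ii jj k = k := fun k h₁ h₂ =>
    Equiv.swap_apply_of_ne_of_ne h₁ h₂
  obtain ⟨C, t, u, hZ⟩ := exists_Z_eq_sum_twoRowZ m r N q Φ α μ hadj σ z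
  have h₁ := hZ σ z fun _ _ _ => ⟨rfl, rfl⟩
  have h₂ := hZ σ (z ∘ Equiv.swap ii jj) fun k hi hj => ⟨rfl, by simp [off k hi hj]⟩
  have h₃ := hZ (σ ∘ Equiv.swap ii jj) z fun k hi hj => ⟨by simp [off k hi hj], rfl⟩
  simp only [Function.comp_apply, Equiv.swap_apply_left, Equiv.swap_apply_right] at h₂ h₃
  have key : (q ^ 2 * z ii - z jj) * Z m r N q Φ α μ σ (z ∘ Equiv.swap ii jj) =
      (q ^ 2 - 1) * (if rep m (σ ii) < rep m (σ jj) then z ii else z jj) * Z m r N q Φ α μ σ z +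
        q * (z jj - z ii) * α (-(σ ii)) (-(σ jj)) *
          Z m r N q Φ α μ (σ ∘ Equiv.swap ii jj) z := by
    rw [h₁, h₂, h₃]
    simp only [Finset.mul_sum, ← Finset.sum_add_distrib]
    refine Finset.sum_congr rfl fun w _ => ?_
    have h := twoRowZ_exchange hq hΦ hα (z ii) (z jj) N 0 (t w) (u w) (some (σ ii))
      (some (σ jj))
    simp only [rMap, hσ, if_false, Nat.cast_zero, add_zero] at h ⊢
    linear_combination C w * h
  have hz' : z jj - z ii ≠ 0 := sub_ne_zero.2 hzz.symm
  have hzj := hz jj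
  have hden : 1 - z ii / z jj = (z jj - z ii) / z jj := by field_simp
  have hκ : (if rep m (σ jj) < rep m (σ ii) then 1 else z ii / z jj) =
      (if rep m (σ ii) < rep m (σ jj) then z ii else z jj) / z jj := by
    rcases lt_or_gt_of_ne ((rep_injective m).ne hσ) with h | h
    · simp [h, h.not_gt]
    · simp [h, h.not_gt, hzj]
  rw [hden, hκ]
  generalize (if rep m (σ ii) < rep m (σ jj) then z ii else z jj) = κ at *
  have hαα := hα (-(σ jj)) (-(σ ii))
  field_simp
  linear_combination (-α (-(σ jj)) (-(σ ii))) * key -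
    q * (z jj - z ii) * Z m r N q Φ α μ (σ ∘ Equiv.swap ii jj) z * hαα
end
end

section
/- RRR Yang–Baxter equation for the fused R-matrix (Theorem B): for every m ≥ 1, every q, Φ ∈ ℂ* and α as specified, all z₁, z₂, z₃ ∈ ℂ, and all boundary spins a, b, c, d, e, f ∈ {+, c_1, …, c_m}: ∑_{i,j,k ∈ {+,c_1,…,c_m}} R(z₁,z₂)(a,b;i,j) · R(z₁,z₃)(i,c;d,k) · R(z₂,z₃)(j,k;e,f) = ∑_{l,m',n ∈ {+,c_1,…,c_m}} R(z₂,z₃)(b,c;l,n) · R(z₁,z₃)(a,n;m',f) · R(z₁,z₂)(m',l;d,e), where in each factor R(z,w)(x,y;x',y') the spins x, x' lie on the line with parameter z and y, y' on the line with parameter w. -/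
noncomputable section

/-- The fused R-matrix `R(z, w)(a, b; c, d)`, where `a` is the input spin on the
`z`-line, `b` the input on the `w`-line, `c` the output on the `z`-line and `d` the
output on the `w`-line; colors are compared via their representatives in `{1, …, m}`. -/
def Rf (m : ℕ) (q Φ : ℂ) (α : ZMod m → ZMod m → ℂ) (z w : ℂ) :
    Spin m → Spin m → Spin m → Spin m → ℂ
  | none, none, none, none => z - q ^ 2 * w
  | some a, some b, some c, some d =>
      if a = b then (if c = a ∧ d = a then w - q ^ 2 * z else 0)
      else if c = b ∧ d = a then (1 - q ^ 2) * (if rep m a < rep m b then z else w)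
      else if c = a ∧ d = b then -q * (z - w) * α (-a) (-b)
      else 0
  | some a, none, none, some d => if d = a then (1 - q ^ 2) * z else 0
  | none, some b, some c, none => if c = b then (1 - q ^ 2) * w else 0
  | none, some b, none, some d => if d = b then -q * (z - w) * Φ else 0
  | some a, none, some c, none => if c = a then -q * (z - w) / Φ else 0
  | _, _, _, _ => 0

section PerkSchultz

variable {S L K : Type*} [DecidableEq S] [LinearOrder L] [CommRing K]

/-- The indicator of `x = y`. -/
def delta (K : Type*) [CommRing K] (x y : S) : K := if x = y then 1 else 0

/-- Weight of a Perk–Schultz vertex at which both lines keep their spins. -/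
def psKeep (ε : S → Bool) (β : S → S → K) (q z w : K) (a b : S) : K :=
  if a = b then (if ε a then z - q ^ 2 * w else w - q ^ 2 * z) else -q * (z - w) * β a b

/-- Weight of a Perk–Schultz vertex at which the lines exchange two distinct spins. -/
def psSwap (r : S → L) (q z w : K) (a b : S) : K :=
  if a = b then 0 else (1 - q ^ 2) * (if r a < r b then z else w)

/-- The twisted Perk–Schultz R-matrix on the set of spins `S`, ordered through `r`; the map `ε`
distinguishes the two kinds of spins. -/
def psR (r : S → L) (ε : S → Bool) (β : S → S → K) (q z w : K) (a b c d : S) : K :=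
  delta K c a * delta K d b * psKeep ε β q z w a b +
    delta K c b * delta K d a * psSwap r q z w a b

lemma sum_delta_mul [Fintype S] (x : S) (F : S → K) : ∑ y, delta K y x * F y = F x := by
  simp [delta]

variable (r : S → L) (ε : S → Bool) (β : S → S → K) (q z w : K)

lemma sum_psR_mul [Fintype S] (a b : S) (F : S → S → K) :
    ∑ i, ∑ j, psR r ε β q z w a b i j * F i j =
      psKeep ε β q z w a b * F a b + psSwap r q z w a b * F b a := by
  simp only [psR, add_mul, mul_assoc, Finset.sum_add_distrib, ← Finset.mul_sum, sum_delta_mul]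

lemma sum_psR_mul_right [Fintype S] (a b c : S) (F : S → K) :
    ∑ j, psR r ε β q z w a b c j * F j =
      delta K c a * psKeep ε β q z w a b * F b + delta K c b * psSwap r q z w a b * F a := by
  simp only [psR, add_mul, mul_assoc, Finset.sum_add_distrib, ← Finset.mul_sum, sum_delta_mul]

lemma sum_psR_mul_left [Fintype S] (a b d : S) (F : S → K) :
    ∑ i, psR r ε β q z w a b i d * F i =
      delta K d b * psKeep ε β q z w a b * F a + delta K d a * psSwap r q z w a b * F b := by
  have (i : S) : psR r ε β q z w a b i d * F i =
      delta K i a * (delta K d b * psKeep ε β q z w a b * F i) +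
        delta K i b * (delta K d a * psSwap r q z w a b * F i) := by
    rw [psR]; ring
  simp only [this, Finset.sum_add_distrib, sum_delta_mul]

theorem psR_yang_baxter [Fintype S] (hr : Function.Injective r)
    (hβ : ∀ x y, x ≠ y → β x y * β y x = 1) (z1 z2 z3 : K) (a b c d e f : S) :
    (∑ i, ∑ j, ∑ k, psR r ε β q z1 z2 a b i j * psR r ε β q z1 z3 i c d k *
        psR r ε β q z2 z3 j k e f) =
      ∑ l, ∑ m, ∑ n, psR r ε β q z2 z3 b c l n * psR r ε β q z1 z3 a n m f *
        psR r ε β q z1 z2 m l d e := by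
  have hL : (∑ i, ∑ j, ∑ k, psR r ε β q z1 z2 a b i j * psR r ε β q z1 z3 i c d k *
      psR r ε β q z2 z3 j k e f) = ∑ i, ∑ j, psR r ε β q z1 z2 a b i j *
        ∑ k, psR r ε β q z1 z3 i c d k * psR r ε β q z2 z3 j k e f := by
    simp only [mul_assoc, Finset.mul_sum]
  have hR : (∑ l, ∑ m, ∑ n, psR r ε β q z2 z3 b c l n * psR r ε β q z1 z3 a n m f *
      psR r ε β q z1 z2 m l d e) = ∑ l, ∑ n, psR r ε β q z2 z3 b c l n *
        ∑ m, psR r ε β q z1 z3 a n m f * psR r ε β q z1 z2 m l d e := by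
    refine Finset.sum_congr rfl fun l _ => ?_
    rw [Finset.sum_comm]
    simp only [mul_assoc, Finset.mul_sum]
  rw [hL, hR, sum_psR_mul r ε β q z1 z2 a b, sum_psR_mul r ε β q z2 z3 b c]
  clear hL hR
  simp only [sum_psR_mul_right, sum_psR_mul_left]
  simp only [psR]
  have tri {x y : S} (h : ¬x = y) : r x < r y ∨ r y < r x := lt_or_gt_of_ne (hr.ne h)
  by_cases hab : a = b
  · subst hab
    by_cases hac : a = c
    · subst hac
      simp only [psKeep, psSwap, if_true]
      ring
    · have hB := hβ a c hac
      rcases tri hac with h | h <;>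
      cases hε : ε a <;>
      simp only [psKeep, psSwap, if_true, hac, Ne.symm hac, if_false, h, h.not_gt, hε,
        Bool.false_eq_true] <;>
      grind
  · by_cases hac : a = c
    · subst hac
      have hB := hβ a b hab
      rcases tri hab with h | h <;>
      cases hε : ε a <;>
      simp only [psKeep, psSwap, if_true, hab, Ne.symm hab, if_false, h, h.not_gt, hε,
        Bool.false_eq_true] <;>
      grind
    · by_cases hbc : b = c
      · subst hbc
        have hB := hβ a b hab
        rcases tri hab with h | h <;>
        cases hε : ε b <;>
        simp only [psKeep, psSwap, if_true, hab, Ne.symm hab, if_false, h, h.not_gt, hε,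
          Bool.false_eq_true] <;>
        grind
      · have hB := hβ a b hab
        have hC := hβ b c hbc
        have hD := hβ a c hac
        rcases tri hab with h | h <;>
        rcases tri hac with h' | h' <;>
        rcases tri hbc with h'' | h'' <;>
        first
        | exact absurd (h.trans h'') h'.not_gt
        | exact absurd (h''.trans h) h'.not_gt
        | (simp only [psKeep, psSwap, hab, Ne.symm hab, hac, hbc, Ne.symm hbc,
             if_true, if_false, h, h.not_gt, h', h'.not_gt, h'', h''.not_gt]
           grind)

end PerkSchultz

/-- Position of a spin in the order `c_1 < ⋯ < c_m < +`. -/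
def spinRank (m : ℕ) : Spin m → ℕ
  | none => m + 1
  | some x => rep m x

/-- The twist of the fused R-matrix. -/
def spinTwist (m : ℕ) (Φ : ℂ) (α : ZMod m → ZMod m → ℂ) : Spin m → Spin m → ℂ
  | none, none => 1
  | none, some _ => Φ
  | some _, none => 1 / Φ
  | some x, some y => α (-x) (-y)

lemma spinRank_injective (m : ℕ) [NeZero m] : Function.Injective (spinRank m) := by
  rintro (_ | x) (_ | y) h
  · rfl
  · have := rep_le m y
    simp only [spinRank] at h
    omega
  · have := rep_le m x
    simp only [spinRank] at h
    omega
  · simpa [spinRank, rep] using (ZMod.val_injective m).eq_iff.mp (Nat.succ_injective h)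

lemma spinTwist_mul_spinTwist (m : ℕ) {Φ : ℂ} (hΦ : Φ ≠ 0) {α : ZMod m → ZMod m → ℂ}
    (hα : ∀ x y, α x y * α y x = 1) (x y : Spin m) :
    spinTwist m Φ α x y * spinTwist m Φ α y x = 1 := by
  cases x <;> cases y <;> simp [spinTwist, hΦ, hα]

lemma Rf_eq_psR (m : ℕ) [NeZero m] (q Φ : ℂ) (α : ZMod m → ZMod m → ℂ) (z w : ℂ) :
    Rf m q Φ α z w = psR (spinRank m) Option.isNone (spinTwist m Φ α) q z w := by
  have hlt (x : ZMod m) : rep m x < m + 1 := Nat.lt_succ_of_le (rep_le m x)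
  funext a b c d
  rcases a with _ | a <;> rcases b with _ | b <;> rcases c with _ | c <;> rcases d with _ | d <;>
    simp [Rf, psR, psKeep, psSwap, delta, spinRank, spinTwist, hlt, (hlt _).not_gt, div_eq_mul_inv]
  all_goals grind

/-- RRR Yang–Baxter equation for the fused R-matrix:
`∑ R(z₁,z₂)(a,b;i,j) R(z₁,z₃)(i,c;d,k) R(z₂,z₃)(j,k;e,f)
 = ∑ R(z₂,z₃)(b,c;l,n) R(z₁,z₃)(a,n;m',f) R(z₁,z₂)(m',l;d,e)`. -/
theorem fused_RRR_yang_baxter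
    (m : ℕ) [NeZero m] (q Φ : ℂ) (hq : q ≠ 0) (hΦ : Φ ≠ 0)
    (α : ZMod m → ZMod m → ℂ) (hα : ∀ x y, α x y * α y x = 1) (hα1 : ∀ x, α x x = 1)
    (z1 z2 z3 : ℂ) (a b c d e f : Spin m) :
    (∑ i : Spin m, ∑ j : Spin m, ∑ k : Spin m,
        Rf m q Φ α z1 z2 a b i j * Rf m q Φ α z1 z3 i c d k * Rf m q Φ α z2 z3 j k e f) =
      ∑ l : Spin m, ∑ m' : Spin m, ∑ n : Spin m,
        Rf m q Φ α z2 z3 b c l n * Rf m q Φ α z1 z3 a n m' f *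
          Rf m q Φ α z1 z2 m' l d e := by
  simp only [Rf_eq_psR]
  exact psR_yang_baxter _ _ _ _ (spinRank_injective m)
    (fun x y _ => spinTwist_mul_spinTwist m hΦ hα x y) z1 z2 z3 a b c d e f
end
end

section
/- Uniqueness of one-row states: fix m ≥ 1 and a single row of M vertices whose column colors are any prescribed sequence (c_{j_1}, …, c_{j_M}) with j_t ∈ {1,…,m}. For any prescribed spins on the left boundary edge, the right boundary edge, and all top and bottom vertical boundary edges, there is at most one assignment of spins to the interior horizontal edges making every vertex admissible. In particular, the one-row transfer matrix entries and the fused vertex weights are given by the weight of at most one state. -/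
/-- The left, top and bottom spins of an admissible vertex determine its right spin. -/
theorem Adm.right_unique {m : ℕ} {j : ZMod m} {a b c c' d : Spin m}
    (hc : Adm m j a b c d) (hc' : Adm m j a b c' d) : c = c' := by
  unfold Adm at hc hc'
  grind

/-- uniqueness of one-row states: in a single row of `M` vertices
with prescribed column colors `c_{j_1}, …, c_{j_M}`, prescribed left and right boundary
spins and prescribed spins on all top and bottom vertical edges, there is at most one
assignment of spins to the (interior) horizontal edges making every vertex admissible.
Here `h t.castSucc` is the left edge and `h t.succ` the right edge of the `t`-th vertex,
so `h 0` is the left boundary edge and `h (Fin.last M)` the right boundary edge. -/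
theorem one_row_state_unique
    (m : ℕ) (hm : 1 ≤ m) (M : ℕ) (jseq : Fin M → ℕ)
    (hjseq : ∀ t, 1 ≤ jseq t ∧ jseq t ≤ m)
    (aL aR : Spin m) (top bot : Fin M → Spin m)
    (h h' : Fin (M + 1) → Spin m)
    (hL : h 0 = aL) (hR : h (Fin.last M) = aR)
    (hL' : h' 0 = aL) (hR' : h' (Fin.last M) = aR)
    (hadm : ∀ t : Fin M,
      Adm m ((jseq t : ℕ) : ZMod m) (h t.castSucc) (top t) (h t.succ) (bot t))
    (hadm' : ∀ t : Fin M,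
      Adm m ((jseq t : ℕ) : ZMod m) (h' t.castSucc) (top t) (h' t.succ) (bot t)) :
    h = h' := by
  funext t
  induction t using Fin.induction with
  | zero => rw [hL, hL']
  | succ t ih =>
    have ht := hadm t
    rw [ih] at ht
    exact ht.right_unique (hadm' t)
end
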